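/- arXiv:2003.00937 — 2 statements merged into one kernel-verified Lean document; each statement's English description precedes it below -/
import Mathlib

section
/- For all positive integers B, q, r with 0 ≤ r < q < B/2, the constant C_{B−r, q−r+1} satisfies C_{B−r, q−r+1} ≤ B · (e/(2π)) · √(B−1) / √((B−q−1)(q−r)), where e is Euler's number. -/
/-- The constant `C_{M,K}` for integers `0 < K ≤ M/2`:
`C_{M,K} = M` if `K = 1`, and
`C_{M,K} = M! (K-1)^{K-1} (M-K)^{M-K} / ((K-1)! (M-K)! (M-1)^{M-1})` otherwise. -/
noncomputable def Cconst (M K : ℕ) : ℝ :=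
  if K = 1 then (M : ℝ)
  else (M.factorial : ℝ) * ((K - 1 : ℕ) : ℝ) ^ (K - 1) * ((M - K : ℕ) : ℝ) ^ (M - K) /
    (((K - 1).factorial : ℝ) * ((M - K).factorial : ℝ) * ((M - 1 : ℕ) : ℝ) ^ (M - 1))

/-- Upper Stirling bound `n! ≤ e √n (n/e)^n` for `n ≥ 1`. -/
theorem factorial_le_exp_one_mul_sqrt_mul_pow {n : ℕ} (hn : n ≠ 0) :
    (n.factorial : ℝ) ≤ Real.exp 1 * √n * (n / Real.exp 1) ^ n := by
  obtain ⟨m, rfl⟩ := Nat.exists_eq_succ_of_ne_zero hn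
  have hanti : Stirling.stirlingSeq (m + 1) ≤ Stirling.stirlingSeq 1 :=
    Stirling.stirlingSeq'_antitone (Nat.zero_le m)
  rw [Stirling.stirlingSeq_one, Stirling.stirlingSeq, div_le_iff₀ (by positivity)] at hanti
  refine hanti.trans_eq ?_
  rw [Real.sqrt_mul zero_le_two]
  field_simp

/-- Stirling-type bound for the normalised binomial coefficient of `k + n`. -/
theorem factorial_add_mul_pow_div_le {k n : ℕ} (hk : k ≠ 0) (hn : n ≠ 0) :
    ((k + n).factorial : ℝ) * (k : ℝ) ^ k * (n : ℝ) ^ n /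
        ((k.factorial : ℝ) * n.factorial * ((k + n : ℕ) : ℝ) ^ (k + n)) ≤
      Real.exp 1 / (2 * Real.pi) * √((k + n : ℕ) : ℝ) / √((n : ℝ) * k) := by
  have hk' : (0 : ℝ) < k := by positivity
  have hn' : (0 : ℝ) < n := by positivity
  have hN : (0 : ℝ) < ((k + n : ℕ) : ℝ) := by positivity
  calc _ ≤ (Real.exp 1 * √((k + n : ℕ) : ℝ) * (((k + n : ℕ) : ℝ) / Real.exp 1) ^ (k + n)) *
          (k : ℝ) ^ k * (n : ℝ) ^ n /
        ((√(2 * Real.pi * k) * (k / Real.exp 1) ^ k) *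
          (√(2 * Real.pi * n) * (n / Real.exp 1) ^ n) * ((k + n : ℕ) : ℝ) ^ (k + n)) := by
        gcongr
        · exact factorial_le_exp_one_mul_sqrt_mul_pow (by omega)
        · exact Stirling.le_factorial_stirling k
        · exact Stirling.le_factorial_stirling n
    _ = _ := by
        have hpi : √(2 * Real.pi) ^ 2 = 2 * Real.pi := Real.sq_sqrt (by positivity)
        rw [Real.sqrt_mul (by positivity) (k : ℝ), Real.sqrt_mul (by positivity) (n : ℝ),
          Real.sqrt_mul hn'.le]
        simp only [div_pow, pow_add (Real.exp 1)]
        field_simp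
        rw [hpi]

/-- for integers `0 ≤ r < q < B/2`,
`C_{B-r, q-r+1} ≤ B · (e/(2π)) · √(B-1) / √((B-q-1)(q-r))`. -/
theorem Cconst_upper_bound (B q r : ℕ) (hB : 0 < B) (hq : 0 < q)
    (hr : r < q) (hqB : 2 * q < B) :
    Cconst (B - r) (q - r + 1) ≤
      (B : ℝ) * (Real.exp 1 / (2 * Real.pi)) * Real.sqrt ((B : ℝ) - 1) /
        Real.sqrt (((B : ℝ) - q - 1) * ((q : ℝ) - r)) := by
  obtain ⟨k, rfl⟩ := Nat.exists_eq_add_of_lt hr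
  obtain ⟨n, rfl⟩ : ∃ n, B = n + (r + k + 1) + 1 := ⟨B - (r + k + 1) - 1, by omega⟩
  have hn : n ≠ 0 := by omega
  have hM : n + (r + k + 1) + 1 - r = (k + 1 + n) + 1 := by omega
  have hK : r + k + 1 - r = k + 1 := by omega
  have hMK : (k + 1 + n) + 1 - (k + 1 + 1) = n := by omega
  have hbound := factorial_add_mul_pow_div_le (Nat.succ_ne_zero k) hn
  rw [hM, hK, Cconst, if_neg (by omega), hMK, Nat.add_sub_cancel, Nat.add_sub_cancel,
    Nat.factorial_succ]
  have hden : (((n + (r + k + 1) + 1 : ℕ) : ℝ) - (r + k + 1 : ℕ) - 1) *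
      (((r + k + 1 : ℕ) : ℝ) - r) = (n : ℝ) * (k + 1 : ℕ) := by
    push_cast; ring
  rw [hden]
  calc _ = ((k + 1 + n + 1 : ℕ) : ℝ) * (((k + 1 + n).factorial : ℝ) *
          ((k + 1 : ℕ) : ℝ) ^ (k + 1) * (n : ℝ) ^ n /
        (((k + 1).factorial : ℝ) * n.factorial * ((k + 1 + n : ℕ) : ℝ) ^ (k + 1 + n))) := by
        rw [Nat.cast_mul]; ring
    _ ≤ ((n + (r + k + 1) + 1 : ℕ) : ℝ) * (Real.exp 1 / (2 * Real.pi) *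
          √(((n + (r + k + 1) + 1 : ℕ) : ℝ) - 1) / √((n : ℝ) * (k + 1 : ℕ))) := by
        refine mul_le_mul (by exact_mod_cast (by omega)) (hbound.trans ?_)
          (by positivity) (by positivity)
        gcongr
        push_cast
        linarith [(Nat.cast_nonneg r : (0 : ℝ) ≤ r)]
    _ = _ := by ring
end

section
/- Let F: ℝ^d → ℝ be differentiable, L-smooth (i.e., ‖∇F(w) − ∇F(w')‖ ≤ L‖w − w'‖ for all w, w' ∈ ℝ^d) with L > 0, and bounded below by F* ∈ ℝ. Let T ≥ 1 be an integer and η = 1/(L√T). On a probability space with a filtration (𝔽_t)_{t=0}^{T}, let w^0 ∈ ℝ^d be deterministic and let (G^t)_{t=0}^{T−1} be random vectors in ℝ^d such that w^{t+1} = w^t − η G^t for 0 ≤ t ≤ T−1, each w^t is 𝔽_t-measurable, and there exist constants V ≥ 0, Δ ≥ 0, D ≥ 0 such that almost surely for every t: E[‖G^t‖² | 𝔽_t] ≤ V, ‖E[G^t | 𝔽_t] − ∇F(w^t)‖ ≤ Δ, and ‖∇F(w^t)‖ ≤ D. Then (1/T) Σ_{t=0}^{T−1} E[‖∇F(w^t)‖²]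 ≤ L(F(w^0) − F*)/√T + V/(2√T) + DΔ. -/
open MeasureTheory

/-- The descent lemma: a function with `L`-Lipschitz gradient lies below its quadratic
upper model. -/
theorem HasGradientAt.le_add_inner_add_sq {E : Type*} [NormedAddCommGroup E]
    [InnerProductSpace ℝ E] [CompleteSpace E] {F : E → ℝ} {gradF : E → E} {L : ℝ}
    (hgrad : ∀ w, HasGradientAt F (gradF w) w)
    (hsmooth : ∀ w w', ‖gradF w - gradF w'‖ ≤ L * ‖w - w'‖) (x v : E) :
    F (x + v) ≤ F x + inner ℝ (gradF x) v + L / 2 * ‖v‖ ^ 2 := by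
  have hderiv : ∀ s : ℝ, HasDerivAt (fun s : ℝ => F (x + s • v))
      (inner ℝ (gradF (x + s • v)) v) s := by
    intro s
    have hline : HasDerivAt (fun s : ℝ => x + s • v) v s := by
      simpa using ((hasDerivAt_id s).smul_const v).const_add x
    exact (hgrad (x + s • v)).hasFDerivAt.comp_hasDerivAt s hline
  have hmodel : ∀ s : ℝ, HasDerivAt
      (fun s : ℝ => F x + s * inner ℝ (gradF x) v + L / 2 * ‖v‖ ^ 2 * s ^ 2)
      (inner ℝ (gradF x) v + L * ‖v‖ ^ 2 * s) s := by
    intro s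
    refine ((((hasDerivAt_id s).mul_const (inner ℝ (gradF x) v)).const_add (F x)).add
      (((hasDerivAt_id s).pow 2).const_mul (L / 2 * ‖v‖ ^ 2))).congr_deriv ?_
    simp only [id, Nat.cast_ofNat]
    ring
  have hle := image_le_of_deriv_right_le_deriv_boundary (a := 0) (b := 1)
    (fun s _ => (hderiv s).continuousAt.continuousWithinAt)
    (fun s _ => (hderiv s).hasDerivWithinAt) (by simp)
    (fun s _ => (hmodel s).continuousAt.continuousWithinAt)
    (fun s _ => (hmodel s).hasDerivWithinAt) (fun s hs => by
      have hcs := real_inner_le_norm (gradF (x + s • v) - gradF x) v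
      have hlip := hsmooth (x + s • v) x
      rw [add_sub_cancel_left, norm_smul, Real.norm_of_nonneg hs.1] at hlip
      rw [inner_sub_left] at hcs
      nlinarith [mul_le_mul_of_nonneg_right hlip (norm_nonneg v)])
    (Set.right_mem_Icc.2 zero_le_one)
  simpa using hle

/-- A random vector whose conditional expectation is within `Δ` of an `m`-measurable vector `g`
bounded by `D` correlates with `g` at least as `‖g‖ ^ 2 - D * Δ` on average. -/
theorem integral_sq_norm_sub_le_integral_inner {Ω E : Type*} [NormedAddCommGroup E]
    [InnerProductSpace ℝ E] [CompleteSpace E] {m m0 : MeasurableSpace Ω} {μ : Measure Ω}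
    [IsProbabilityMeasure μ] (hm : m ≤ m0) {g G : Ω → E} {D Δ : ℝ}
    (hg : StronglyMeasurable[m] g) (hG : Integrable G μ)
    (hgD : ∀ᵐ ω ∂μ, ‖g ω‖ ≤ D) (hbias : ∀ᵐ ω ∂μ, ‖(μ[G | m]) ω - g ω‖ ≤ Δ) :
    Integrable (fun ω => inner ℝ (g ω) (G ω)) μ ∧
      ∫ ω, ‖g ω‖ ^ 2 ∂μ - D * Δ ≤ ∫ ω, inner ℝ (g ω) (G ω) ∂μ := by
  have hg0 : AEStronglyMeasurable g μ := (hg.mono hm).aestronglyMeasurable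
  have hinner : ∀ {H : Ω → E}, Integrable H μ → Integrable (fun ω => inner ℝ (g ω) (H ω)) μ := by
    intro H hH
    refine (hH.norm.const_mul D).mono' (hg0.inner hH.aestronglyMeasurable) ?_
    filter_upwards [hgD] with ω hω
    exact (norm_inner_le_norm _ _).trans (mul_le_mul_of_nonneg_right hω (norm_nonneg _))
  have hsq : Integrable (fun ω => ‖g ω‖ ^ 2) μ := by
    refine Integrable.of_bound (hg0.norm.pow 2) (D ^ 2) ?_
    filter_upwards [hgD] with ω hω
    rw [Real.norm_of_nonneg (sq_nonneg _)]
    exact pow_le_pow_left₀ (norm_nonneg _) hω 2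
  refine ⟨hinner hG, ?_⟩
  have hpull : μ[fun ω => inner ℝ (g ω) (G ω) | m] =ᵐ[μ]
      fun ω => inner ℝ (g ω) ((μ[G | m]) ω) :=
    condExp_bilin_of_stronglyMeasurable_left (innerSL ℝ) hg (hinner hG) hG
  rw [← integral_condExp hm (f := fun ω => inner ℝ (g ω) (G ω)), integral_congr_ae hpull]
  calc ∫ ω, ‖g ω‖ ^ 2 ∂μ - D * Δ = ∫ ω, (‖g ω‖ ^ 2 - D * Δ) ∂μ := by
        rw [integral_sub hsq (integrable_const _)]; simp
    _ ≤ ∫ ω, inner ℝ (g ω) ((μ[G | m]) ω) ∂μ := by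
        refine integral_mono_ae (hsq.sub (integrable_const _)) (hinner integrable_condExp) ?_
        filter_upwards [hgD, hbias] with ω hωD hωΔ
        have hcs := neg_le_of_abs_le (abs_real_inner_le_norm (g ω) ((μ[G | m]) ω - g ω))
        rw [inner_sub_right, real_inner_self_eq_norm_sq] at hcs
        have := mul_le_mul hωD hωΔ (norm_nonneg _) ((norm_nonneg _).trans hωD)
        linarith

/-- convergence of the buffered asynchronous SGD iterates. If
`F : ℝ^d → ℝ` is differentiable, `L`-smooth and bounded below by `F*`,
`η = 1/(L√T)`, `w^{t+1} = w^t - η G^t`, each `w^t` is `𝔽_t`-measurable, and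
almost surely `E[‖G^t‖² | 𝔽_t] ≤ V`, `‖E[G^t | 𝔽_t] - ∇F(w^t)‖ ≤ Δ` and
`‖∇F(w^t)‖ ≤ D` for every `t < T`, then
`(1/T) Σ_{t<T} E[‖∇F(w^t)‖²] ≤ L(F(w^0) - F*)/√T + V/(2√T) + DΔ`. -/
theorem basgd_convergence
    (d : ℕ) (hd : 1 ≤ d)
    (F : EuclideanSpace ℝ (Fin d) → ℝ)
    (gradF : EuclideanSpace ℝ (Fin d) → EuclideanSpace ℝ (Fin d))
    (hgrad : ∀ w, HasGradientAt F (gradF w) w)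
    (L : ℝ) (hL : 0 < L)
    (hsmooth : ∀ w w', ‖gradF w - gradF w'‖ ≤ L * ‖w - w'‖)
    (Fstar : ℝ) (hbounded : ∀ w, Fstar ≤ F w)
    (T : ℕ) (hT : 1 ≤ T)
    (η : ℝ) (hη : η = 1 / (L * Real.sqrt T))
    (Ω : Type*) [m0 : MeasurableSpace Ω] (μ : Measure Ω) [IsProbabilityMeasure μ]
    (𝔽 : ℕ → MeasurableSpace Ω) (hmono : Monotone 𝔽) (hle : ∀ t, 𝔽 t ≤ m0)
    (w G : ℕ → Ω → EuclideanSpace ℝ (Fin d))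
    (w0 : EuclideanSpace ℝ (Fin d)) (hw0 : ∀ ω, w 0 ω = w0)
    (hupdate : ∀ t < T, ∀ ω, w (t + 1) ω = w t ω - η • G t ω)
    (hwmeas : ∀ t ≤ T, StronglyMeasurable[𝔽 t] (w t))
    (hGint : ∀ t < T, Integrable (G t) μ)
    (hGsqint : ∀ t < T, Integrable (fun ω => ‖G t ω‖ ^ 2) μ)
    (V Δ D : ℝ) (hV : 0 ≤ V) (hΔ : 0 ≤ Δ) (hD : 0 ≤ D)
    (hvar : ∀ t < T, ∀ᵐ ω ∂μ, (μ[fun ω' => ‖G t ω'‖ ^ 2 | 𝔽 t]) ω ≤ V)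
    (hbias : ∀ t < T, ∀ᵐ ω ∂μ, ‖(μ[G t | 𝔽 t]) ω - gradF (w t ω)‖ ≤ Δ)
    (hgradbdd : ∀ t < T, ∀ᵐ ω ∂μ, ‖gradF (w t ω)‖ ≤ D) :
    (1 / (T : ℝ)) * ∑ t ∈ Finset.range T, ∫ ω, ‖gradF (w t ω)‖ ^ 2 ∂μ ≤
      L * (F w0 - Fstar) / Real.sqrt T + V / (2 * Real.sqrt T) + D * Δ := by
  have hsqrt : 0 < Real.sqrt T := Real.sqrt_pos.2 (by exact_mod_cast hT)
  have hηpos : 0 < η := by rw [hη]; positivity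
  have hFcont : Continuous F := continuous_iff_continuousAt.2 fun x => (hgrad x).continuousAt
  have hgradcont : Continuous gradF :=
    (LipschitzWith.of_dist_le_mul (K := ⟨L, hL.le⟩) fun x y => by
      rw [dist_eq_norm, dist_eq_norm]
      exact hsmooth x y).continuous
  have hstep : ∀ t < T, Integrable (fun ω => F (w t ω)) μ →
      Integrable (fun ω => F (w (t + 1) ω)) μ ∧
      ∫ ω, F (w (t + 1) ω) ∂μ + η * ∫ ω, ‖gradF (w t ω)‖ ^ 2 ∂μ ≤
        ∫ ω, F (w t ω) ∂μ + η * (D * Δ) + L / 2 * η ^ 2 * V := by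
    intro t ht hF
    obtain ⟨hint, hcorr⟩ := integral_sq_norm_sub_le_integral_inner (hle t)
      (hgradcont.comp_stronglyMeasurable (hwmeas t ht.le)) (hGint t ht)
      (hgradbdd t ht) (hbias t ht)
    have hsecond : ∫ ω, ‖G t ω‖ ^ 2 ∂μ ≤ V := by
      rw [← integral_condExp (hle t)]
      simpa using integral_mono_ae integrable_condExp (integrable_const V) (hvar t ht)
    have hdescent : ∀ ω, F (w (t + 1) ω) ≤ F (w t ω) - η * inner ℝ (gradF (w t ω)) (G t ω) +
        L / 2 * η ^ 2 * ‖G t ω‖ ^ 2 := by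
      intro ω
      have h := HasGradientAt.le_add_inner_add_sq hgrad hsmooth (w t ω) (-(η • G t ω))
      rw [← sub_eq_add_neg, ← hupdate t ht ω, inner_neg_right, real_inner_smul_right, norm_neg,
        norm_smul, mul_pow, Real.norm_eq_abs, sq_abs] at h
      linarith
    have hlin : Integrable (fun ω => F (w t ω) - η * inner ℝ (gradF (w t ω)) (G t ω)) μ :=
      hF.sub (hint.const_mul η)
    have hquad := (hGsqint t ht).const_mul (L / 2 * η ^ 2)
    have hnext : Integrable (fun ω => F (w (t + 1) ω)) μ :=
      integrable_of_le_of_le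
        (hFcont.comp_aestronglyMeasurable
          ((hwmeas (t + 1) ht).mono (hle (t + 1))).aestronglyMeasurable)
        (ae_of_all _ fun ω => hbounded _) (ae_of_all _ hdescent) (integrable_const Fstar)
        (hlin.add hquad)
    refine ⟨hnext, ?_⟩
    have hmean : ∫ ω, F (w (t + 1) ω) ∂μ ≤ ∫ ω, F (w t ω) ∂μ -
        η * ∫ ω, inner ℝ (gradF (w t ω)) (G t ω) ∂μ +
          L / 2 * η ^ 2 * ∫ ω, ‖G t ω‖ ^ 2 ∂μ := by
      rw [← integral_const_mul, ← integral_const_mul, ← integral_sub hF (hint.const_mul η),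
        ← integral_add hlin hquad]
      exact integral_mono hnext (hlin.add hquad) hdescent
    have h₁ := mul_le_mul_of_nonneg_left hcorr hηpos.le
    have h₂ := mul_le_mul_of_nonneg_left hsecond (by positivity : 0 ≤ L / 2 * η ^ 2)
    linarith
  have htelescope : ∀ n ≤ T, Integrable (fun ω => F (w n ω)) μ ∧
      ∫ ω, F (w n ω) ∂μ + η * ∑ t ∈ Finset.range n, ∫ ω, ‖gradF (w t ω)‖ ^ 2 ∂μ ≤
        F w0 + n * (η * (D * Δ) + L / 2 * η ^ 2 * V) := by
    intro n
    induction n with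
    | zero => intro _; simp [hw0]
    | succ n ih =>
      intro hn
      obtain ⟨hF, hsum⟩ := ih (by omega)
      obtain ⟨hF', hone⟩ := hstep n hn hF
      refine ⟨hF', ?_⟩
      rw [Finset.sum_range_succ]
      push_cast
      linarith
  obtain ⟨hF, hsum⟩ := htelescope T le_rfl
  have hlower : Fstar ≤ ∫ ω, F (w T ω) ∂μ := by
    simpa using integral_mono (integrable_const Fstar) hF fun ω => hbounded (w T ω)
  set S := ∑ t ∈ Finset.range T, ∫ ω, ‖gradF (w t ω)‖ ^ 2 ∂μ
  have hTsq : (T : ℝ) = Real.sqrt T ^ 2 := (Real.sq_sqrt (Nat.cast_nonneg T)).symm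
  have hηS : η * S ≤ F w0 - Fstar + T * (η * (D * Δ) + L / 2 * η ^ 2 * V) := by linarith
  have hscale := mul_le_mul_of_nonneg_left hηS (by positivity : 0 ≤ L / Real.sqrt T)
  generalize Real.sqrt T = r at *
  rw [hTsq] at hscale ⊢
  subst hη
  calc 1 / r ^ 2 * S = L / r * (1 / (L * r) * S) := by field_simp
    _ ≤ _ := hscale
    _ = _ := by field_simp; ring
end
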